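/- Let Z_1,...,Z_n be independent standard Gaussian random variables and let 0 < δ < 1/2. Then P(|√(Z_1² + ... + Z_n²) − √n| ≤ n^δ) ≥ 1 − C e^{−c n^{2δ}}, where c, C > 0 are universal constants. -/

import Mathlib

open MeasureTheory ProbabilityTheory Real

section GaussianNorm

/-- The moment generating function of the square of a standard Gaussian variable at `t < 1 / 2`,
parametrized as `t = (1 - u⁻²) / 2`. -/
lemma mgf_sq_gaussianReal {u : ℝ} (hu : 0 < u) :
    mgf (fun x : ℝ => x ^ 2) (gaussianReal 0 1) ((1 - (u ^ 2)⁻¹) / 2) = u := by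
  rw [mgf, integral_gaussianReal_eq_integral_smul one_ne_zero]
  have hfun : ∀ x : ℝ, gaussianPDFReal 0 1 x • rexp ((1 - (u ^ 2)⁻¹) / 2 * x ^ 2) =
      (√(2 * π))⁻¹ * rexp (-((u ^ 2)⁻¹ / 2) * x ^ 2) := by
    intro x
    rw [gaussianPDFReal_def, smul_eq_mul]
    simp only [NNReal.coe_one, mul_one, sub_zero]
    rw [mul_assoc, ← Real.exp_add]
    ring_nf
  simp_rw [hfun]
  rw [integral_const_mul, integral_gaussian,
    show π / ((u ^ 2)⁻¹ / 2) = 2 * π * u ^ 2 by field_simp,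
    Real.sqrt_mul (by positivity : 0 ≤ 2 * π), Real.sqrt_sq hu.le]
  exact inv_mul_cancel_left₀ (by positivity) u

variable {Ω : Type*} [MeasurableSpace Ω] {P : Measure Ω}
  {n : ℕ} {Z : Fin n → Ω → ℝ}

lemma mgf_sum_sq_gaussian (hZ : ∀ i, Measurable (Z i)) (hindep : iIndepFun Z P)
    (hlaw : ∀ i, P.map (Z i) = gaussianReal 0 1) {u : ℝ} (hu : 0 < u) :
    mgf (fun ω => ∑ i, Z i ω ^ 2) P ((1 - (u ^ 2)⁻¹) / 2) = u ^ n := by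
  have hindep' : iIndepFun (fun i ω => Z i ω ^ 2) P :=
    hindep.comp (fun _ x => x ^ 2) (fun _ => by fun_prop)
  have hsum : (fun ω => ∑ i, Z i ω ^ 2) = ∑ i, fun ω => Z i ω ^ 2 := by
    ext ω
    simp
  rw [hsum, hindep'.mgf_sum (fun i => (hZ i).pow_const 2)]
  have hterm : ∀ i, mgf (fun ω => Z i ω ^ 2) P ((1 - (u ^ 2)⁻¹) / 2) = u := by
    intro i
    have h := mgf_sq_gaussianReal hu
    rwa [← hlaw i, mgf_map (hZ i).aemeasurable (by fun_prop)] at h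
  simp [hterm]

lemma integrable_exp_mul_sum_sq_gaussian (hZ : ∀ i, Measurable (Z i)) (hindep : iIndepFun Z P)
    (hlaw : ∀ i, P.map (Z i) = gaussianReal 0 1) {u : ℝ} (hu : 0 < u) :
    Integrable (fun ω => rexp ((1 - (u ^ 2)⁻¹) / 2 * ∑ i, Z i ω ^ 2)) P := by
  by_contra h
  have h0 := mgf_sum_sq_gaussian hZ hindep hlaw hu
  rw [mgf_undef h] at h0
  exact (pow_pos hu n).ne h0

lemma exp_neg_mul_pow_le_exp_neg_sq (n : ℕ) {u : ℝ} (hu : 0 < u) :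
    rexp (-((1 - (u ^ 2)⁻¹) / 2) * (n * u ^ 2)) * u ^ n ≤ rexp (-(n * (u - 1) ^ 2 / 2)) := by
  have hpow : u ^ n ≤ rexp (n * (u - 1)) := by
    rw [Real.exp_nat_mul]
    gcongr
    linarith [Real.add_one_le_exp (u - 1)]
  calc rexp (-((1 - (u ^ 2)⁻¹) / 2) * (n * u ^ 2)) * u ^ n
      ≤ rexp (-((1 - (u ^ 2)⁻¹) / 2) * (n * u ^ 2)) * rexp (n * (u - 1)) := by gcongr
    _ = rexp (-(n * (u - 1) ^ 2 / 2)) := by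
      rw [← Real.exp_add]
      congr 1
      field_simp
      ring

variable [IsProbabilityMeasure P]

lemma measureReal_sum_sq_gaussian_ge_le (hZ : ∀ i, Measurable (Z i)) (hindep : iIndepFun Z P)
    (hlaw : ∀ i, P.map (Z i) = gaussianReal 0 1) {u : ℝ} (hu : 1 ≤ u) :
    P.real {ω | n * u ^ 2 ≤ ∑ i, Z i ω ^ 2} ≤ rexp (-(n * (u - 1) ^ 2 / 2)) := by
  have hu0 : 0 < u := by linarith
  have ht : 0 ≤ (1 - (u ^ 2)⁻¹) / 2 := by
    have := inv_le_one_of_one_le₀ (one_le_pow₀ hu : 1 ≤ u ^ 2)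
    linarith
  refine (measure_ge_le_exp_mul_mgf _ ht
    (integrable_exp_mul_sum_sq_gaussian hZ hindep hlaw hu0)).trans ?_
  rw [mgf_sum_sq_gaussian hZ hindep hlaw hu0]
  exact exp_neg_mul_pow_le_exp_neg_sq n hu0

lemma measureReal_sum_sq_gaussian_le_le (hZ : ∀ i, Measurable (Z i)) (hindep : iIndepFun Z P)
    (hlaw : ∀ i, P.map (Z i) = gaussianReal 0 1) {u : ℝ} (hu0 : 0 < u) (hu : u ≤ 1) :
    P.real {ω | ∑ i, Z i ω ^ 2 ≤ n * u ^ 2} ≤ rexp (-(n * (u - 1) ^ 2 / 2)) := by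
  have ht : (1 - (u ^ 2)⁻¹) / 2 ≤ 0 := by
    have := (one_le_inv₀ (by positivity)).2 (pow_le_one₀ hu0.le hu : u ^ 2 ≤ 1)
    linarith
  refine (measure_le_le_exp_mul_mgf _ ht
    (integrable_exp_mul_sum_sq_gaussian hZ hindep hlaw hu0)).trans ?_
  rw [mgf_sum_sq_gaussian hZ hindep hlaw hu0]
  exact exp_neg_mul_pow_le_exp_neg_sq n hu0

/-- Sub-Gaussian deviation of the norm of a standard Gaussian vector from `√n`. -/
lemma measureReal_lt_abs_sqrt_sum_sq_gaussian_sub_le (hZ : ∀ i, Measurable (Z i))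
    (hindep : iIndepFun Z P) (hlaw : ∀ i, P.map (Z i) = gaussianReal 0 1) (hn : n ≠ 0)
    {r : ℝ} (hr : 0 ≤ r) :
    P.real {ω | r < |√(∑ i, Z i ω ^ 2) - √n|} ≤ 2 * rexp (-(r ^ 2 / 2)) := by
  have hn0 : (0 : ℝ) < √n := Real.sqrt_pos.2 (by positivity)
  have hsq : √(n : ℝ) ^ 2 = n := Real.sq_sqrt (by positivity)
  have hmul : ∀ a : ℝ, n * (1 + a / √n) ^ 2 = (√n + a) ^ 2 := by
    intro a
    rw [← hsq, Real.sqrt_sq hn0.le]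
    field_simp
  have hexp : ∀ a : ℝ, n * (1 + a / √n - 1) ^ 2 / 2 = a ^ 2 / 2 := by
    intro a
    rw [← hsq, Real.sqrt_sq hn0.le]
    field_simp
    ring
  have hupper : P.real {ω | √n + r < √(∑ i, Z i ω ^ 2)} ≤ rexp (-(r ^ 2 / 2)) := by
    have h := measureReal_sum_sq_gaussian_ge_le hZ hindep hlaw
      (le_add_of_nonneg_right (by positivity) : 1 ≤ 1 + r / √n)
    rw [hmul, hexp] at h
    refine (measureReal_mono fun ω hω => ?_).trans h
    exact ((Real.lt_sqrt (by positivity)).1 hω).le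
  have hlower : P.real {ω | √(∑ i, Z i ω ^ 2) < √n - r} ≤ rexp (-(r ^ 2 / 2)) := by
    rcases lt_or_ge r √n with hrn | hrn
    · have hpos : 0 < 1 + -r / √n := by
        rw [neg_div, ← sub_eq_add_neg, sub_pos]
        exact (div_lt_one hn0).2 hrn
      have hle : 1 + -r / √n ≤ 1 := by
        rw [neg_div]
        linarith [div_nonneg hr hn0.le]
      have h := measureReal_sum_sq_gaussian_le_le hZ hindep hlaw hpos hle
      rw [hmul, hexp, neg_sq, ← sub_eq_add_neg] at h
      refine (measureReal_mono fun ω hω => ?_).trans h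
      exact ((Real.sqrt_lt' (by linarith)).1 hω).le
    · have hempty : {ω | √(∑ i, Z i ω ^ 2) < √n - r} = ∅ := by
        ext ω
        simp only [Set.mem_ofPred_eq, Set.mem_empty_iff_false, iff_false, not_lt]
        linarith [Real.sqrt_nonneg (∑ i, Z i ω ^ 2)]
      rw [hempty, measureReal_empty]
      positivity
  have hsub : {ω | r < |√(∑ i, Z i ω ^ 2) - √n|} ⊆
      {ω | √n + r < √(∑ i, Z i ω ^ 2)} ∪ {ω | √(∑ i, Z i ω ^ 2) < √n - r} := by
    intro ω hω
    rw [Set.mem_ofPred_eq, lt_abs] at hω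
    rcases hω with h | h
    · exact Or.inl (by simp only [Set.mem_ofPred_eq]; linarith)
    · exact Or.inr (by simp only [Set.mem_ofPred_eq]; linarith)
  linarith [(measureReal_mono (μ := P) hsub).trans (measureReal_union_le _ _)]

end GaussianNorm

/-- Concentration of the norm of a standard Gaussian vector:
`P(|√(Z₁²+⋯+Zₙ²) - √n| ≤ n^δ) ≥ 1 - C e^{-c n^{2δ}}` for `0 < δ < 1/2`. -/
theorem gaussian_norm_concentration :
    ∃ c C : ℝ, 0 < c ∧ 0 < C ∧
      ∀ (n : ℕ) (Ω : Type) [MeasureSpace Ω] [IsProbabilityMeasure (ℙ : Measure Ω)]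
        (Z : Fin n → Ω → ℝ),
        (∀ i, Measurable (Z i)) →
        iIndepFun Z ℙ →
        (∀ i, Measure.map (Z i) ℙ = gaussianReal 0 1) →
        ∀ δ : ℝ, 0 < δ → δ < 1 / 2 →
          1 - C * Real.exp (-c * (n : ℝ) ^ (2 * δ)) ≤
            (ℙ {ω | |Real.sqrt (∑ i, (Z i ω) ^ 2) - Real.sqrt n| ≤ (n : ℝ) ^ δ}).toReal := by
  refine ⟨1 / 2, 2, by norm_num, by norm_num, ?_⟩
  intro n Ω _ _ Z hZ hindep hlaw δ hδ _
  rcases eq_or_ne n 0 with rfl | hn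
  · have h0 : ((0 : ℕ) : ℝ) ^ (2 * δ) = 0 := by
      rw [Nat.cast_zero, Real.zero_rpow (by positivity)]
    rw [h0, mul_zero, Real.exp_zero]
    exact le_trans (by norm_num) ENNReal.toReal_nonneg
  · have hmeas : MeasurableSet {ω | |√(∑ i, Z i ω ^ 2) - √n| ≤ (n : ℝ) ^ δ} :=
      measurableSet_le (by fun_prop) measurable_const
    have hpow : ((n : ℝ) ^ δ) ^ 2 = (n : ℝ) ^ (2 * δ) := by
      rw [mul_comm, Real.rpow_mul (by positivity), Real.rpow_two]
    have htail := measureReal_lt_abs_sqrt_sum_sq_gaussian_sub_le hZ hindep hlaw hn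
      (by positivity : 0 ≤ (n : ℝ) ^ δ)
    have hcompl : {ω | (n : ℝ) ^ δ < |√(∑ i, Z i ω ^ 2) - √n|} =
        {ω | |√(∑ i, Z i ω ^ 2) - √n| ≤ (n : ℝ) ^ δ}ᶜ := by
      ext ω
      simp
    rw [hcompl, probReal_compl_eq_one_sub hmeas, hpow,
      show -((n : ℝ) ^ (2 * δ) / 2) = -(1 / 2) * (n : ℝ) ^ (2 * δ) by ring] at htail
    rw [← measureReal_def]
    linarith
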